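/- For each integer i, the ℤ-span of the nonnegative kernel ker⁺L_i equals ker L_i. Consequently, an i-chain σ satisfies σ·h = 0 for all h ∈ ker⁺L_i if and only if σ·τ = 0 for all τ ∈ ker L_i. -/

import Mathlib

open Finset Matrix

/-- A finite abstract simplicial complex on the vertex set `Fin n`: a collection of
finite subsets of `Fin n` (its faces) closed under taking subsets. -/
structure SComplex (n : ℕ) where
  faces : Finset (Finset (Fin n))
  down_closed : ∀ s ∈ faces, ∀ t ⊆ s, t ∈ faces

namespace SComplex

variable {n : ℕ} (Δ : SComplex n)

/-- The faces of cardinality `k`, i.e. the `(k-1)`-dimensional faces. -/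
def Faces (k : ℕ) : Finset (Finset (Fin n)) :=
  Δ.faces.filter fun f => f.card = k

/-- The group of `(k-1)`-dimensional chains: formal `ℤ`-linear combinations of the
faces of cardinality `k`.  (So `Chain 0` plays the role of `C_{-1}(Δ) ≅ ℤ`, generated
by the empty face, and `Chain (i+1)` is the group `C_i(Δ)` of `i`-dimensional chains.) -/
abbrev Chain (k : ℕ) : Type := {f // f ∈ Δ.Faces k} → ℤ

/-- The sign `(-1)^j` with which the subface `g` (obtained from `f` by deleting its
`j`-th smallest vertex) occurs in the boundary of `f`; `0` if `g` is not a
codimension-one subface of `f`. -/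
def bcoef (f g : Finset (Fin n)) : ℤ :=
  if g ⊆ f ∧ f.card = g.card + 1 then
    ∑ v ∈ f \ g, (-1 : ℤ) ^ (f.filter (fun x => x < v)).card
  else 0

/-- The matrix (in the standard bases, with the standard orientation) of the boundary
map from chains on faces of cardinality `k+1` to chains on faces of cardinality `k`. -/
def B (k : ℕ) : Matrix {f // f ∈ Δ.Faces k} {f // f ∈ Δ.Faces (k + 1)} ℤ :=
  fun g f => bcoef (f : Finset (Fin n)) (g : Finset (Fin n))

/-- The simplicial boundary map `∂_k : C_k(Δ) → C_{k-1}(Δ)` (standard orientation),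
as a map `Chain (k+1) → Chain k`.  For `k = 0` this is the reduced boundary map into
`C_{-1}(Δ) ≅ ℤ`. -/
noncomputable def bdry (k : ℕ) : Δ.Chain (k + 1) →ₗ[ℤ] Δ.Chain k :=
  (Δ.B k).mulVecLin

/-- The transpose `∂_kᵗ` of the boundary map. -/
noncomputable def tbdry (k : ℕ) : Δ.Chain k →ₗ[ℤ] Δ.Chain (k + 1) :=
  ((Δ.B k)ᵀ).mulVecLin

/-- The matrix of the `i`-th (up-down combinatorial) Laplacian. -/
def LapM (i : ℕ) : Matrix {f // f ∈ Δ.Faces (i + 1)} {f // f ∈ Δ.Faces (i + 1)} ℤ :=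
  Δ.B (i + 1) * (Δ.B (i + 1))ᵀ

/-- The `i`-th Laplacian `L_i = ∂_{i+1} ∘ ∂_{i+1}ᵗ` on `i`-dimensional chains. -/
noncomputable def Lap (i : ℕ) : Δ.Chain (i + 1) →ₗ[ℤ] Δ.Chain (i + 1) :=
  (Δ.LapM i).mulVecLin

/-- A chain is effective if all of its coefficients are nonnegative. -/
def Effective {k : ℕ} (σ : Δ.Chain k) : Prop := ∀ f, 0 ≤ σ f

/-- `σ·h = Σ_f σ(f)h(f)`. -/
def dot {k : ℕ} (σ h : Δ.Chain k) : ℤ := ∑ f, σ f * h f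

/-- The `i`-th nonnegative kernel `ker⁺L_i`: effective `i`-chains in `ker L_i`. -/
def kerPlus (i : ℕ) : Set (Δ.Chain (i + 1)) :=
  {τ | Δ.Lap i τ = 0 ∧ Δ.Effective τ}

/-- Two `i`-chains are linearly equivalent if their difference lies in `im L_i`. -/
def LinEquiv (i : ℕ) (σ σ' : Δ.Chain (i + 1)) : Prop :=
  σ' - σ ∈ LinearMap.range (Δ.Lap i)

/-- An `i`-chain is winnable if it is linearly equivalent to an effective `i`-chain. -/
def Winnable (i : ℕ) (σ : Δ.Chain (i + 1)) : Prop :=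
  ∃ σ', Δ.Effective σ' ∧ Δ.LinEquiv i σ σ'

/-- The Hilbert basis of `ker⁺L_i`: its nonzero elements that are not the sum of two
nonzero elements of `ker⁺L_i`. -/
def hilbBasis (i : ℕ) : Set (Δ.Chain (i + 1)) :=
  {τ | τ ∈ Δ.kerPlus i ∧ τ ≠ 0 ∧
    ¬ ∃ a ∈ Δ.kerPlus i, ∃ b ∈ Δ.kerPlus i, a ≠ 0 ∧ b ≠ 0 ∧ τ = a + b}

/-- The cycles among the chains on faces of cardinality `k`: the kernel of the
(reduced) boundary map `∂_{k-1}`.  For `k = 0` (the `(-1)`-chains, where the boundary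
map is zero) every chain is a cycle. -/
noncomputable def cycles : (k : ℕ) → Submodule ℤ (Δ.Chain k)
  | 0 => ⊤
  | (k + 1) => LinearMap.ker (Δ.bdry k)

/-- The image of the `i`-th Laplacian, viewed inside the `i`-cycles. -/
noncomputable def critSub (i : ℕ) : Submodule ℤ ↥(Δ.cycles (i + 1)) :=
  Submodule.comap (Δ.cycles (i + 1)).subtype (LinearMap.range (Δ.Lap i))

/-- The `i`-th critical group `crit_i(Δ) = ker ∂_i / im L_i`. -/
noncomputable abbrev Crit (i : ℕ) : Type :=
  ↥(Δ.cycles (i + 1)) ⧸ Δ.critSub i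

/-- The image of the boundary map `∂_k`, viewed inside the cycles `cycles k`. -/
noncomputable def bdrySub (k : ℕ) : Submodule ℤ ↥(Δ.cycles k) :=
  Submodule.comap (Δ.cycles k).subtype (LinearMap.range (Δ.bdry k))

/-- The reduced homology group `H̃_{k-1}(Δ) = ker ∂_{k-1} / im ∂_k` (so the `i`-th
reduced homology group of `Δ` is `RedHomologyAt (i+1)`). -/
noncomputable abbrev RedHomologyAt (k : ℕ) : Type :=
  ↥(Δ.cycles k) ⧸ Δ.bdrySub k

/-- The orthogonal complement `(ker L_i)^⊥` of `ker L_i` in the `i`-chains. -/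
def kerPerp (i : ℕ) : Submodule ℤ (Δ.Chain (i + 1)) where
  carrier := {σ | ∀ τ ∈ LinearMap.ker (Δ.Lap i), Δ.dot σ τ = 0}
  add_mem' := by
    intro a b ha hb τ hτ
    have h : Δ.dot (a + b) τ = Δ.dot a τ + Δ.dot b τ := by
      simp [dot, Pi.add_apply, add_mul, Finset.sum_add_distrib]
    rw [h, ha τ hτ, hb τ hτ, add_zero]
  zero_mem' := by
    intro τ hτ
    simp [dot]
  smul_mem' := by
    intro c a ha τ hτ
    have h : Δ.dot (c • a) τ = c * Δ.dot a τ := by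
      simp [dot, Pi.smul_apply, Finset.mul_sum, mul_assoc]
    rw [h, ha τ hτ, mul_zero]

/-! ### Pseudomanifolds -/

/-- `Δ` is a pseudomanifold of dimension `d` (the facets are the faces of
cardinality `d+1`): it is pure, non-branching, and strongly connected. -/
def IsPseudomanifold (d : ℕ) : Prop :=
  (∀ f ∈ Δ.faces, ∃ g ∈ Δ.Faces (d + 1), f ⊆ g) ∧
  (∀ g ∈ Δ.Faces d, ((Δ.Faces (d + 1)).filter fun f => g ⊆ f).card ≤ 2) ∧
  (∀ f ∈ Δ.Faces (d + 1), ∀ f' ∈ Δ.Faces (d + 1),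
    Relation.ReflTransGen
      (fun a b => a ∈ Δ.Faces (d + 1) ∧ b ∈ Δ.Faces (d + 1) ∧ (a ∩ b).card = d) f f')

/-- The boundary `∂Δ` of a `d`-dimensional pseudomanifold: the `(d-1)`-faces contained
in exactly one facet. -/
def pmBoundary (d : ℕ) : Finset (Finset (Fin n)) :=
  (Δ.Faces d).filter fun g => ((Δ.Faces (d + 1)).filter fun f => g ⊆ f).card = 1

/-- A pseudomanifold orientation for a `d`-dimensional pseudomanifold: a top chain
`γ` with all coefficients `±1` whose boundary is supported on `∂Δ`. -/
noncomputable def IsOrientation (d : ℕ) (γ : Δ.Chain (d + 1)) : Prop :=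
  (∀ f, γ f = 1 ∨ γ f = -1) ∧
  (∀ g : {f // f ∈ Δ.Faces d},
    (g : Finset (Fin n)) ∉ Δ.pmBoundary d → Δ.bdry d γ g = 0)

/-- `γ_j` as a top-dimensional chain, for a vertex `j` of the `γ`-incidence graph:
the extra vertex `γ_0 = 0` is encoded by `none`, and the oriented facet `γ_f` by
`some f`. -/
noncomputable def gammaInd (D : ℕ) (γ : Δ.Chain (D + 1)) :
    Option {f // f ∈ Δ.Faces (D + 1)} → Δ.Chain (D + 1)
  | none => 0
  | some f => Pi.single f (γ f)

/-- The edge of the `γ`-incidence graph corresponding to the `(D-1)`-dimensional face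
`σ` goes from the vertex `a` to the vertex `b`: this means `∂ᵗ(σ) = γ_b - γ_a`. -/
noncomputable def edgeFromTo (D : ℕ) (γ : Δ.Chain (D + 1)) (σ : {f // f ∈ Δ.Faces D})
    (a b : Option {f // f ∈ Δ.Faces (D + 1)}) : Prop :=
  Δ.tbdry D (Pi.single σ 1) = Δ.gammaInd D γ b - Δ.gammaInd D γ a

/-- `τ` is the incidence vector of a simple directed cycle of the `γ`-incidence graph
`Γ(Δ,γ)`: there is a closed directed walk with pairwise distinct vertices and pairwise
distinct edges whose edge labels sum to `τ`. -/
noncomputable def IsCycleVector (D : ℕ) (γ : Δ.Chain (D + 1)) (τ : Δ.Chain D) : Prop :=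
  ∃ (k : ℕ) (hk : 0 < k) (v : Fin k → Option {f // f ∈ Δ.Faces (D + 1)})
    (e : Fin k → {f // f ∈ Δ.Faces D}),
    Function.Injective v ∧ Function.Injective e ∧
    (∀ t : Fin k, Δ.edgeFromTo D γ (e t) (v t) (v ⟨(t.1 + 1) % k, Nat.mod_lt _ hk⟩)) ∧
    τ = ∑ t : Fin k, Pi.single (e t) (1 : ℤ)

/-! ### Spanning forests -/

/-- The chains supported on a set `F` of faces. -/
def suppIn (k : ℕ) (F : Finset (Finset (Fin n))) : Submodule ℤ (Δ.Chain k) where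
  carrier := {σ | ∀ f : {f // f ∈ Δ.Faces k}, (f : Finset (Fin n)) ∉ F → σ f = 0}
  add_mem' := by
    intro a b ha hb f hf
    simp [Pi.add_apply, ha f hf, hb f hf]
  zero_mem' := by intro f hf; rfl
  smul_mem' := by
    intro c a ha f hf
    simp [Pi.smul_apply, ha f hf]

/-- The reduced homology group `H̃_{i-1}(Υ)` of the subcomplex `Υ` with
`Skel_{i-1}(Υ) = Skel_{i-1}(Δ)` and with set of `i`-faces `F`: namely
`ker ∂_{i-1} / ∂_i(chains supported on F)`. -/
noncomputable abbrev forestHom (i : ℕ) (F : Finset (Finset (Fin n))) : Type :=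
  ↥(Δ.cycles i) ⧸ Submodule.comap (Δ.cycles i).subtype
      (Submodule.map (Δ.bdry i) (Δ.suppIn (i + 1) F))

/-- `F ⊆ Δ_i` encodes a spanning `i`-forest of `Δ`: the `i`-dimensional subcomplex
`Υ` with `Skel_{i-1}(Υ) = Skel_{i-1}(Δ)` and with `i`-faces `F`, subject to:
`H̃_i(Υ) = 0`; `β̃_{i-1}(Υ) = β̃_{i-1}(Δ)`; and `|Υ_i| = |Δ_i| - β̃_i(Skel_i(Δ))`
(note `H̃_i(Skel_i(Δ)) = ker ∂_i` since `Skel_i(Δ)` has no `(i+1)`-faces). -/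
noncomputable def IsSpanningForest (i : ℕ) (F : Finset (Finset (Fin n))) : Prop :=
  F ⊆ Δ.Faces (i + 1) ∧
  (∀ σ ∈ Δ.suppIn (i + 1) F, Δ.bdry i σ = 0 → σ = 0) ∧
  Module.finrank ℤ (Δ.forestHom i F) = Module.finrank ℤ (Δ.RedHomologyAt i) ∧
  F.card = (Δ.Faces (i + 1)).card - Module.finrank ℤ ↥(Δ.cycles (i + 1))

open scoped Classical in
/-- The `i`-forest number `τ_i(Δ) = Σ_Υ |T(H̃_{i-1}(Υ))|²`, the sum over all spanning
`i`-forests of `Δ`. -/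
noncomputable def forestNumber (i : ℕ) : ℕ :=
  ∑ F ∈ (Δ.Faces (i + 1)).powerset.filter (fun F => Δ.IsSpanningForest i F),
    (Nat.card ↥(Submodule.torsion ℤ (Δ.forestHom i F))) ^ 2

/-- Restriction of chains to the coordinates indexed by a subset `Θ` of the faces
(i.e. setting the remaining coordinates to `0`). -/
noncomputable def restrictTo (k : ℕ) (Θ : Finset (Finset (Fin n)))
    (hΘ : Θ ⊆ Δ.Faces k) : Δ.Chain k →ₗ[ℤ] ({f // f ∈ Θ} → ℤ) where
  toFun σ := fun a => σ ⟨a.1, hΘ a.2⟩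
  map_add' := by intros; rfl
  map_smul' := by intros; rfl

/-- The reduced Laplacian: the square submatrix of `L_i` consisting of the rows
and columns indexed by `Θ`, as a linear map `ℤΘ → ℤΘ`. -/
noncomputable def redLap (i : ℕ) (Θ : Finset (Finset (Fin n)))
    (hΘ : Θ ⊆ Δ.Faces (i + 1)) : ({f // f ∈ Θ} → ℤ) →ₗ[ℤ] ({f // f ∈ Θ} → ℤ) :=
  (Matrix.of fun a b : {f // f ∈ Θ} =>
    Δ.LapM i ⟨a.1, hΘ a.2⟩ ⟨b.1, hΘ b.2⟩).mulVecLin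

end SComplex

namespace SComplex

/-- The coboundary of a cochain `φ` on all finite sets of vertices. -/
def coboundary {α : Type*} [LinearOrder α] (φ : Finset α → ℤ) (f : Finset α) : ℤ :=
  ∑ v ∈ f, (-1) ^ #{x ∈ f | x < v} * φ (f.erase v)

theorem card_filter_lt_erase {α : Type*} [LinearOrder α] {f : Finset α} {u v : α}
    (hu : u ∈ f) :
    #{x ∈ f.erase u | x < v} + (if u < v then 1 else 0) = #{x ∈ f | x < v} := by
  rw [Finset.filter_erase]
  split_ifs with h
  · exact Finset.card_erase_add_one (by simp [hu, h])
  · rw [Finset.erase_eq_of_notMem (by simp [h]), add_zero]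

theorem coboundary_coboundary {α : Type*} [LinearOrder α] (φ : Finset α → ℤ) (f : Finset α) :
    coboundary (coboundary φ) f = 0 := by
  set T : α → α → ℤ := fun u v =>
    (-1) ^ #{x ∈ f | x < u} * ((-1) ^ #{x ∈ f.erase u | x < v} * φ ((f.erase u).erase v))
  have hsum : coboundary (coboundary φ) f = ∑ u ∈ f, ∑ v ∈ f.erase u, T u v := by
    simp only [coboundary, Finset.mul_sum, T]
  have hanti : ∀ u ∈ f, ∀ v ∈ f.erase u, T u v = -T v u := by
    intro u hu v hv
    obtain ⟨hvu, hv⟩ := Finset.mem_erase.1 hv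
    simp only [T]
    rw [Finset.erase_right_comm, ← card_filter_lt_erase (v := u) hv,
      ← card_filter_lt_erase (v := v) hu]
    rcases lt_or_gt_of_ne hvu with h | h <;> simp only [h, h.not_gt, if_true, if_false] <;> ring
  have hswap : ∑ u ∈ f, ∑ v ∈ f.erase u, T u v = ∑ u ∈ f, ∑ v ∈ f.erase u, T v u :=
    Finset.sum_comm' fun u v => by simp only [Finset.mem_erase]; tauto
  have hneg : ∑ u ∈ f, ∑ v ∈ f.erase u, T u v = -∑ u ∈ f, ∑ v ∈ f.erase u, T v u := by
    simp only [← Finset.sum_neg_distrib]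
    exact Finset.sum_congr rfl fun u hu => Finset.sum_congr rfl (hanti u hu)
  rw [hsum]
  linarith

/-- The coboundary of `g ↦ (n + 1) ^ ∑ v ∈ g, v` is positive: the term that deletes the
smallest vertex dominates all the others. -/
theorem coboundary_pow_sum_pos {n : ℕ} {f : Finset (Fin n)} (hf : f.Nonempty) :
    0 < coboundary (fun g : Finset (Fin n) => ((n : ℤ) + 1) ^ ∑ v ∈ g, (v : ℕ)) f := by
  set e : Fin n → ℕ := fun v => ∑ x ∈ f.erase v, (x : ℕ)
  set m := f.min' hf
  have hm : m ∈ f := f.min'_mem hf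
  have hm0 : #{x ∈ f | x < m} = 0 := by
    rw [Finset.card_eq_zero, Finset.filter_eq_empty_iff]
    exact fun x hx => not_lt.2 (f.min'_le x hx)
  have hterm : ∀ v ∈ f.erase m,
      -((n : ℤ) + 1) ^ e m ≤ ((n : ℤ) + 1) * ((-1) ^ #{x ∈ f | x < v} * ((n : ℤ) + 1) ^ e v) := by
    intro v hv
    have hlt : (m : ℕ) < v := f.min'_lt_of_mem_erase_min' hf hv
    have hev : e v + v = e m + m := by
      rw [Finset.sum_erase_add _ _ (Finset.mem_of_mem_erase hv), Finset.sum_erase_add _ _ hm]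
    have hle : ((n : ℤ) + 1) ^ (e v + 1) ≤ ((n : ℤ) + 1) ^ e m :=
      pow_le_pow_right₀ (by omega) (by omega)
    have hpos : (0 : ℤ) < ((n : ℤ) + 1) ^ (e v + 1) := by positivity
    rw [pow_succ] at hle hpos
    rcases neg_one_pow_eq_or ℤ #{x ∈ f | x < v} with h | h <;> rw [h] <;> linarith
  have hcard : (#(f.erase m) : ℤ) ≤ n := by
    exact_mod_cast (Finset.card_le_univ _).trans_eq (Fintype.card_fin n)
  have hrest := Finset.card_nsmul_le_sum (f.erase m) _ _ hterm
  rw [← Finset.mul_sum, nsmul_eq_mul] at hrest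
  have hpos : (0 : ℤ) < ((n : ℤ) + 1) ^ e m := by positivity
  rw [coboundary, ← Finset.add_sum_erase _ _ hm, hm0, pow_zero, one_mul]
  refine pos_of_mul_pos_right (a := (n : ℤ) + 1) ?_ (by positivity)
  nlinarith

theorem bcoef_erase {n : ℕ} {f : Finset (Fin n)} {v : Fin n} (hv : v ∈ f) :
    bcoef f (f.erase v) = (-1) ^ #{x ∈ f | x < v} := by
  rw [bcoef, if_pos ⟨Finset.erase_subset _ _, (Finset.card_erase_add_one hv).symm⟩,
    Finset.sdiff_erase_self hv, Finset.sum_singleton]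

theorem exists_erase_of_bcoef_ne_zero {n : ℕ} {f g : Finset (Fin n)} (h : bcoef f g ≠ 0) :
    ∃ v ∈ f, f.erase v = g := by
  have hg : g ⊆ f ∧ f.card = g.card + 1 := by
    by_contra hg
    exact h (if_neg hg)
  obtain ⟨v, hv⟩ := Finset.card_eq_one.1
    (show #(f \ g) = 1 by rw [Finset.card_sdiff_of_subset hg.1]; omega)
  have hvf : v ∈ f \ g := by simp [hv]
  exact ⟨v, (Finset.mem_sdiff.1 hvf).1, by
    rw [← Finset.sdiff_singleton_eq_erase, ← hv, Finset.sdiff_sdiff_eq_self hg.1]⟩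

theorem tbdry_apply {n : ℕ} (Δ : SComplex n) (k : ℕ) (φ : Finset (Fin n) → ℤ)
    (f : {f // f ∈ Δ.Faces (k + 1)}) :
    Δ.tbdry k (fun g => φ g) f = coboundary φ f := by
  obtain ⟨f, hf⟩ := f
  have hf' := Finset.mem_filter.1 hf
  have himage : f.image f.erase ⊆ Δ.Faces k := by
    intro g hg
    obtain ⟨v, hv, rfl⟩ := Finset.mem_image.1 hg
    refine Finset.mem_filter.2 ⟨Δ.down_closed f hf'.1 _ (Finset.erase_subset _ _), ?_⟩
    rw [Finset.card_erase_of_mem hv, hf'.2, Nat.add_sub_cancel]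
  calc Δ.tbdry k (fun g => φ g) ⟨f, hf⟩
      = ∑ g : {g // g ∈ Δ.Faces k}, bcoef f g * φ g := rfl
    _ = ∑ g ∈ Δ.Faces k, bcoef f g * φ g :=
        Finset.sum_coe_sort (Δ.Faces k) fun g => bcoef f g * φ g
    _ = ∑ g ∈ f.image f.erase, bcoef f g * φ g := by
        refine (Finset.sum_subset himage fun g _ hg => ?_).symm
        by_contra h
        exact hg (Finset.mem_image.2 (exists_erase_of_bcoef_ne_zero (left_ne_zero_of_mul h)))
    _ = coboundary φ f := by
        rw [Finset.sum_image (Finset.erase_injOn f)]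
        exact Finset.sum_congr rfl fun v hv => by rw [bcoef_erase hv]

theorem exists_pos_mem_ker_Lap {n : ℕ} (Δ : SComplex n) (i : ℕ) :
    ∃ τ ∈ LinearMap.ker (Δ.Lap i), ∀ f, 0 < τ f := by
  refine ⟨fun g => coboundary (fun g : Finset (Fin n) => ((n : ℤ) + 1) ^ ∑ v ∈ g, (v : ℕ)) g, ?_,
    fun f => ?_⟩
  · rw [LinearMap.mem_ker, Lap, LapM, Matrix.mulVecLin_mul, LinearMap.comp_apply]
    change Δ.bdry (i + 1) (Δ.tbdry (i + 1) _) = 0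
    rw [← map_zero (Δ.bdry (i + 1))]
    congr 1
    ext f
    rw [tbdry_apply, coboundary_coboundary, Pi.zero_apply]
  · refine coboundary_pow_sum_pos (Finset.card_pos.1 ?_)
    rw [(Finset.mem_filter.1 f.2).2]
    exact i.succ_pos

theorem span_kerPlus {n : ℕ} (Δ : SComplex n) (i : ℕ) :
    Submodule.span ℤ (Δ.kerPlus i) = LinearMap.ker (Δ.Lap i) := by
  refine le_antisymm (Submodule.span_le.2 fun τ hτ => hτ.1) fun x hx => ?_
  obtain ⟨τ, hτ, hpos⟩ := Δ.exists_pos_mem_ker_Lap i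
  set m : ℤ := ∑ f, |x f|
  have hm : 0 ≤ m := Finset.sum_nonneg fun f _ => abs_nonneg _
  have hadd : x + m • τ ∈ Δ.kerPlus i := by
    refine ⟨Submodule.add_mem _ hx (Submodule.smul_mem _ m hτ), fun f => ?_⟩
    have hxm : |x f| ≤ m :=
      Finset.single_le_sum (f := fun f => |x f|) (fun f _ => abs_nonneg _) (Finset.mem_univ f)
    have hmul : m * 1 ≤ m * τ f := mul_le_mul_of_nonneg_left (hpos f) hm
    have hneg := neg_abs_le (x f)
    simp only [Pi.add_apply, Pi.smul_apply, smul_eq_mul]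
    linarith
  have hτ' : τ ∈ Δ.kerPlus i := ⟨hτ, fun f => (hpos f).le⟩
  rw [← add_sub_cancel_right x (m • τ)]
  exact Submodule.sub_mem _ (Submodule.subset_span hadd)
    (Submodule.smul_mem _ m (Submodule.subset_span hτ'))

end SComplex

/-- The `ℤ`-span of the nonnegative kernel `ker⁺L_i` equals
`ker L_i`; consequently `σ·h = 0` for all `h ∈ ker⁺L_i` iff `σ·τ = 0` for all
`τ ∈ ker L_i`. -/
theorem span_kerPlus_eq_ker {n : ℕ} (Δ : SComplex n) (i : ℕ) :
    Submodule.span ℤ (Δ.kerPlus i) = LinearMap.ker (Δ.Lap i) ∧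
    ∀ σ : Δ.Chain (i + 1),
      ((∀ h ∈ Δ.kerPlus i, Δ.dot σ h = 0) ↔
        (∀ τ ∈ LinearMap.ker (Δ.Lap i), Δ.dot σ τ = 0)) := by
  refine ⟨Δ.span_kerPlus i, fun σ => ⟨fun h τ hτ => ?_, fun h τ hτ => h τ hτ.1⟩⟩
  rw [← Δ.span_kerPlus i] at hτ
  exact (Submodule.span_le (p := LinearMap.ker (dotProductBilin ℤ ℤ σ))).2 h hτ
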